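/- (Theorem 2.10, (b) ⇒ (a)) Assume hypotheses (H1)–(H4). Suppose there exists a continuous V : [0,∞) × C([−r,0]; ℝⁿ) → [0,∞) such that: (i) there exist a₁, a₂ ∈ K∞ with a₁(‖x‖_r) ≤ V(t,x) ≤ a₂(‖x‖_r) for all (t,x); (ii) V⁰(t, x; f(t,x,d)) ≤ −V(t,x) for all (t,x,d) ∈ [0,∞) × C([−r,0]; ℝⁿ) × D; (iii) there is a non-decreasing M : [0,∞) → [0,∞) with |V(t,y) − V(t,x)| ≤ M(R)‖y−x‖_r whenever t ∈ [0,R] and ‖x‖_r, ‖y‖_r ≤ R. Then 0 ∈ C([−r,0]; ℝⁿ) is URGAS: there exists σ ∈ KL such that every maximal solution with data (t₀, x₀, d) ∈ [0,∞) × C([−r,0]; ℝⁿ) × M_D is defined on [t₀,∞) and satisfies ‖T_r(t)x‖_r ≤ σ(‖x₀‖_r, t−t₀) for all t ≥ t₀. -/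

import Mathlib

open Set Filter MeasureTheory
open scoped RealInnerProductSpace

noncomputable section

/-- ℝⁿ with the Euclidean norm. -/
abbrev Euc (n : ℕ) : Type := EuclideanSpace ℝ (Fin n)

/-- The sup norm `‖y‖_q = max_{θ ∈ [-q,0]} |y θ|` of a history segment. -/
def histNorm (n : ℕ) (q : ℝ) (y : ℝ → Euc n) : ℝ :=
  sSup ((fun θ => ‖y θ‖) '' Icc (-q) 0)

/-- The class `M_D` of allowed disturbances: right-continuous maps `d : [0,∞) → D`
which are continuous outside a countable set with no finite accumulation point. -/
def MD (l : ℕ) (D : Set (Euc l)) (d : ℝ → Euc l) : Prop :=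
  (∀ t, 0 ≤ t → d t ∈ D) ∧
  (∀ t, 0 ≤ t → ∀ ε > 0, ∃ δ > 0, ∀ s, t ≤ s → s - t < δ → ‖d s - d t‖ < ε) ∧
  ∃ A : Set ℝ, (∀ C : ℝ, (A ∩ Icc 0 C).Finite) ∧
    ∀ t, 0 ≤ t → t ∉ A → ∀ ε > 0, ∃ δ > 0, ∀ s, 0 ≤ s → |s - t| < δ → ‖d s - d t‖ < ε

/-- The operator `E_h(x;v)`. -/
def Eop (n : ℕ) (x : ℝ → Euc n) (h : ℝ) (v : Euc n) : ℝ → Euc n :=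
  fun θ => if -h < θ then x 0 + (θ + h) • v else x (θ + h)

/-- The generalized (Dini-type) derivative
`V⁰(t,x;v) = limsup_{h→0⁺, y→0} (V(t+h, E_h(x;v)+h y) - V(t,x))/h` of a functional `V`
defined on `[0,∞) × C([-q,0];ℝⁿ)`, with values in the extended reals. -/
def Vdot (n : ℕ) (q : ℝ) (V : ℝ → (ℝ → Euc n) → ℝ) (t : ℝ)
    (x : ℝ → Euc n) (v : Euc n) : EReal :=
  ⨅ δ : Ioi (0:ℝ), ⨆ p : {p : ℝ × (ℝ → Euc n) //
      0 < p.1 ∧ p.1 < (δ : ℝ) ∧ ContinuousOn p.2 (Icc (-q) 0) ∧ histNorm n q p.2 < (δ : ℝ)},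
    (((V (t + p.1.1) (fun θ => Eop n x p.1.1 v θ + p.1.1 • p.1.2 θ) - V t x) / p.1.1 : ℝ) : EReal)

/-- The upper right Dini derivative `D⁺v(t) = limsup_{h→0⁺} (v(t+h)-v(t))/h`. -/
def DiniUpper (v : ℝ → ℝ) (t : ℝ) : EReal :=
  Filter.limsup (fun h => (((v (t + h) - v t) / h : ℝ) : EReal)) (nhdsWithin 0 (Ioi 0))

/-- Class `K∞` functions (on `[0,∞)`). -/
def IsKInf (a : ℝ → ℝ) : Prop :=
  ContinuousOn a (Ici 0) ∧ StrictMonoOn a (Ici 0) ∧ a 0 = 0 ∧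
  (∀ s, 0 ≤ s → 0 ≤ a s) ∧ Filter.Tendsto a Filter.atTop Filter.atTop

/-- Class `K⁺`: positive continuous functions on `[0,∞)`. -/
def IsKPlus (b : ℝ → ℝ) : Prop :=
  ContinuousOn b (Ici 0) ∧ ∀ t, 0 ≤ t → 0 < b t

/-- Class `KL` functions. -/
def IsKL (σ : ℝ → ℝ → ℝ) : Prop :=
  ContinuousOn (fun p : ℝ × ℝ => σ p.1 p.2) (Ici 0 ×ˢ Ici 0) ∧
  (∀ s t, 0 ≤ s → 0 ≤ t → 0 ≤ σ s t) ∧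
  (∀ t, 0 ≤ t → StrictMonoOn (fun s => σ s t) (Ici 0) ∧ σ 0 t = 0) ∧
  (∀ s, 0 ≤ s → AntitoneOn (σ s) (Ici 0)) ∧
  (∀ s, 0 ≤ s → Filter.Tendsto (σ s) Filter.atTop (nhds 0))

/-- Hypothesis (H1): a one-sided Lipschitz estimate. -/
def H1 (n l : ℕ) (r : ℝ) (D : Set (Euc l)) (f : ℝ → (ℝ → Euc n) → Euc l → Euc n) : Prop :=
  ∃ L : ℝ → ℝ → ℝ,
    ContinuousOn (fun p : ℝ × ℝ => L p.1 p.2) (Ici 0 ×ˢ Ici 0) ∧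
    (∀ t, 0 ≤ t → MonotoneOn (L t) (Ici 0)) ∧
    (∀ s, 0 ≤ s → MonotoneOn (fun t => L t s) (Ici 0)) ∧
    (∀ t s, 0 ≤ t → 0 ≤ s → 0 ≤ L t s) ∧
    ∀ t x y d, 0 ≤ t → ContinuousOn x (Icc (-r) 0) → ContinuousOn y (Icc (-r) 0) → d ∈ D →
      (inner ℝ (x 0 - y 0) (f t x d - f t y d) : ℝ) ≤
        L t (histNorm n r x + histNorm n r y) * (histNorm n r (x - y))^2

/-- Hypothesis (H2): `f` maps bounded sets to bounded sets, uniformly in `d ∈ D`. -/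
def H2 (n l : ℕ) (r : ℝ) (D : Set (Euc l)) (f : ℝ → (ℝ → Euc n) → Euc l → Euc n) : Prop :=
  ∀ Tb Rb : ℝ, ∃ C : ℝ, ∀ t x d, 0 ≤ t → t ≤ Tb → ContinuousOn x (Icc (-r) 0) →
    histNorm n r x ≤ Rb → d ∈ D → ‖f t x d‖ ≤ C

/-- Hypothesis (H3): continuity off a countable exceptional set of times with no finite
accumulation point, plus right-continuity in time everywhere. -/
def H3 (n l : ℕ) (r : ℝ) (D : Set (Euc l)) (f : ℝ → (ℝ → Euc n) → Euc l → Euc n) : Prop :=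
  ∃ A : Set ℝ, (∀ C : ℝ, (A ∩ Icc 0 C).Finite) ∧
    (∀ t x d, 0 ≤ t → t ∉ A → ContinuousOn x (Icc (-r) 0) → d ∈ D →
      ∀ ε > 0, ∃ δ > 0, ∀ t' x' d', 0 ≤ t' → ContinuousOn x' (Icc (-r) 0) → d' ∈ D →
        |t' - t| < δ → histNorm n r (x' - x) < δ → ‖d' - d‖ < δ →
          ‖f t' x' d' - f t x d‖ < ε) ∧
    (∀ t x d, 0 ≤ t → ContinuousOn x (Icc (-r) 0) → d ∈ D →
      ∀ ε > 0, ∃ δ > 0, ∀ t', t ≤ t' → t' - t < δ → ‖f t' x d - f t x d‖ < ε)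

/-- Hypothesis (H4). -/
def H4 (n l : ℕ) (r : ℝ) (D : Set (Euc l)) (f : ℝ → (ℝ → Euc n) → Euc l → Euc n) : Prop :=
  ∀ ε > 0, ∀ t, 0 ≤ t → ∃ δ > 0, ∀ τ x d, 0 ≤ τ → d ∈ D → ContinuousOn x (Icc (-r) 0) →
    |τ - t| + histNorm n r x < δ → ‖f τ x d‖ < ε

/-- A solution of the RFDE on `[t₀ - r, T)` (continuous, absolutely continuous on compact
subintervals of `[t₀,T)` and satisfying the equation a.e., expressed in integral form). -/
def IsSolIco (n l : ℕ) (r : ℝ) (f : ℝ → (ℝ → Euc n) → Euc l → Euc n) (d : ℝ → Euc l)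
    (t₀ T : ℝ) (x : ℝ → Euc n) : Prop :=
  ContinuousOn x (Ico (t₀ - r) T) ∧
  ∀ t ∈ Ico t₀ T,
    IntervalIntegrable (fun s => f s (fun θ => x (s + θ)) (d s)) volume t₀ t ∧
    x t = x t₀ + ∫ s in t₀..t, f s (fun θ => x (s + θ)) (d s)

/-- A solution of the RFDE on all of `[t₀ - r, ∞)`. -/
def IsSolGlobal (n l : ℕ) (r : ℝ) (f : ℝ → (ℝ → Euc n) → Euc l → Euc n) (d : ℝ → Euc l)
    (t₀ : ℝ) (x : ℝ → Euc n) : Prop :=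
  ContinuousOn x (Ici (t₀ - r)) ∧
  ∀ t, t₀ ≤ t →
    IntervalIntegrable (fun s => f s (fun θ => x (s + θ)) (d s)) volume t₀ t ∧
    x t = x t₀ + ∫ s in t₀..t, f s (fun θ => x (s + θ)) (d s)

/-- Non-uniform in time robust global asymptotic stability of `0` for the RFDE:
every maximal solution is defined on `[t₀,∞)` and satisfies the `KL` estimate (2.6). -/
def RGASnu (n l : ℕ) (r : ℝ) (D : Set (Euc l))
    (f : ℝ → (ℝ → Euc n) → Euc l → Euc n) : Prop :=
  ∃ σ : ℝ → ℝ → ℝ, ∃ β : ℝ → ℝ, IsKL σ ∧ IsKPlus β ∧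
    (∀ t₀ x₀ d, 0 ≤ t₀ → ContinuousOn x₀ (Icc (-r) 0) → MD l D d →
      ∃ x : ℝ → Euc n, IsSolGlobal n l r f d t₀ x ∧ ∀ θ ∈ Icc (-r) 0, x (t₀ + θ) = x₀ θ) ∧
    (∀ t₀ x₀ d x, 0 ≤ t₀ → ContinuousOn x₀ (Icc (-r) 0) → MD l D d →
      IsSolGlobal n l r f d t₀ x → (∀ θ ∈ Icc (-r) 0, x (t₀ + θ) = x₀ θ) →
      ∀ t, t₀ ≤ t →
        histNorm n r (fun θ => x (t + θ)) ≤ σ (β t₀ * histNorm n r x₀) (t - t₀))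

/-- Uniform robust global asymptotic stability of `0` for the RFDE. -/
def URGAS (n l : ℕ) (r : ℝ) (D : Set (Euc l))
    (f : ℝ → (ℝ → Euc n) → Euc l → Euc n) : Prop :=
  ∃ σ : ℝ → ℝ → ℝ, IsKL σ ∧
    (∀ t₀ x₀ d, 0 ≤ t₀ → ContinuousOn x₀ (Icc (-r) 0) → MD l D d →
      ∃ x : ℝ → Euc n, IsSolGlobal n l r f d t₀ x ∧ ∀ θ ∈ Icc (-r) 0, x (t₀ + θ) = x₀ θ) ∧
    (∀ t₀ x₀ d x, 0 ≤ t₀ → ContinuousOn x₀ (Icc (-r) 0) → MD l D d →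
      IsSolGlobal n l r f d t₀ x → (∀ θ ∈ Icc (-r) 0, x (t₀ + θ) = x₀ θ) →
      ∀ t, t₀ ≤ t →
        histNorm n r (fun θ => x (t + θ)) ≤ σ (histNorm n r x₀) (t - t₀))

open scoped Topology

section HistNorm

variable {n : ℕ} {r : ℝ}

theorem histNorm_le (hr : 0 ≤ r) {y : ℝ → Euc n} {c : ℝ}
    (h : ∀ θ ∈ Icc (-r) 0, ‖y θ‖ ≤ c) : histNorm n r y ≤ c := by
  refine csSup_le ((nonempty_Icc.2 (by linarith)).image _) ?_
  rintro _ ⟨θ, hθ, rfl⟩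
  exact h θ hθ

theorem norm_le_histNorm {y : ℝ → Euc n} (hy : ContinuousOn y (Icc (-r) 0)) {θ : ℝ}
    (hθ : θ ∈ Icc (-r) 0) : ‖y θ‖ ≤ histNorm n r y :=
  le_csSup (isCompact_Icc.image_of_continuousOn hy.norm).bddAbove ⟨θ, hθ, rfl⟩

theorem histNorm_nonneg (y : ℝ → Euc n) : 0 ≤ histNorm n r y := by
  apply Real.sSup_nonneg
  rintro _ ⟨θ, -, rfl⟩
  exact norm_nonneg _

theorem histNorm_congr {x y : ℝ → Euc n} (h : EqOn x y (Icc (-r) 0)) :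
    histNorm n r x = histNorm n r y := by
  unfold histNorm
  rw [image_congr fun θ hθ => by rw [h hθ]]

theorem continuousOn_history {x : ℝ → Euc n} {t₀ b t : ℝ}
    (hx : ContinuousOn x (Icc (t₀ - r) b)) (ht : t ∈ Icc t₀ b) :
    ContinuousOn (fun θ => x (t + θ)) (Icc (-r) 0) :=
  hx.comp (by fun_prop) fun θ hθ => ⟨by linarith [hθ.1, ht.1], by linarith [hθ.2, ht.2]⟩

/-- The history segment of a continuous function depends continuously on time. -/
theorem exists_histNorm_history_sub_lt (hr : 0 ≤ r) {x : ℝ → Euc n} {t₀ b : ℝ}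
    (hx : ContinuousOn x (Icc (t₀ - r) b)) {ε : ℝ} (hε : 0 < ε) :
    ∃ δ > 0, ∀ t ∈ Icc t₀ b, ∀ t' ∈ Icc t₀ b, |t' - t| < δ →
      histNorm n r ((fun θ => x (t' + θ)) - fun θ => x (t + θ)) < ε := by
  obtain ⟨δ, hδ, h⟩ := Metric.uniformContinuousOn_iff.1
    (isCompact_Icc.uniformContinuousOn_of_continuous hx) (ε / 2) (by positivity)
  refine ⟨δ, hδ, fun t ht t' ht' htt' => ?_⟩
  refine (histNorm_le hr (c := ε / 2) fun θ hθ => ?_).trans_lt (by linarith)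
  have := h (t' + θ) ⟨by linarith [hθ.1, ht'.1], by linarith [hθ.2, ht'.2]⟩ (t + θ)
    ⟨by linarith [hθ.1, ht.1], by linarith [hθ.2, ht.2]⟩
    (by rw [Real.dist_eq]; convert htt' using 2; ring)
  rw [dist_eq_norm] at this
  exact this.le

end HistNorm

section RightHandSide

variable {n l : ℕ} {r : ℝ} {D : Set (Euc l)} {f : ℝ → (ℝ → Euc n) → Euc l → Euc n}

/-- Under (H3), `f t x d` depends on `x` only through its restriction to `[-r, 0]`. -/
theorem H3.congr (hr : 0 ≤ r) (h3 : H3 n l r D f) {t : ℝ} {x y : ℝ → Euc n} {d : Euc l}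
    (ht : 0 ≤ t) (hd : d ∈ D) (hx : ContinuousOn x (Icc (-r) 0)) (h : EqOn x y (Icc (-r) 0)) :
    f t x d = f t y d := by
  obtain ⟨A, hA, hc, hrc⟩ := h3
  have hy : ContinuousOn y (Icc (-r) 0) := hx.congr h.symm
  have hnorm : histNorm n r (y - x) ≤ 0 := histNorm_le hr fun θ hθ => by simp [h hθ]
  have key : ∀ s, 0 ≤ s → s ∉ A → f s x d = f s y d := by
    intro s hs hsA
    refine eq_of_forall_dist_le fun ε hε => ?_
    obtain ⟨δ, hδ, H⟩ := hc s x d hs hsA hx hd ε hε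
    rw [dist_comm, dist_eq_norm]
    exact (H s y d hs hy hd (by simpa) (by linarith) (by simpa)).le
  refine eq_of_forall_dist_le fun ε hε => ?_
  obtain ⟨δ₁, hδ₁, H₁⟩ := hrc t x d ht hx hd (ε / 2) (by positivity)
  obtain ⟨δ₂, hδ₂, H₂⟩ := hrc t y d ht hy hd (ε / 2) (by positivity)
  obtain ⟨s, hs, hsA⟩ : ∃ s ∈ Ioo t (t + min δ₁ δ₂), s ∉ A := by
    have hinf : (Ioo t (t + min δ₁ δ₂)).Infinite := Ioo_infinite (by simp [hδ₁, hδ₂])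
    obtain ⟨s, hs, hsA⟩ := hinf.exists_notMem_finite (hA (t + min δ₁ δ₂))
    exact ⟨s, hs, fun hA' => hsA ⟨hA', by linarith [hs.1], hs.2.le⟩⟩
  have e₁ := H₁ s hs.1.le (by linarith [hs.2, min_le_left δ₁ δ₂])
  have e₂ := H₂ s hs.1.le (by linarith [hs.2, min_le_right δ₁ δ₂])
  rw [key s (by linarith [hs.1]) hsA, ← dist_eq_norm, dist_comm] at e₁
  rw [← dist_eq_norm] at e₂
  linarith [dist_triangle (f t x d) (f s y d) (f t y d)]

/-- Along a continuous curve the right-hand side of the equation is continuous in time outside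
a locally finite set, which does not depend on the curve. -/
theorem H3.exists_continuous_along (hr : 0 ≤ r) (h3 : H3 n l r D f) {d : ℝ → Euc l}
    (hd : MD l D d) :
    ∃ A : Set ℝ, (∀ C : ℝ, (A ∩ Icc 0 C).Finite) ∧
      ∀ t₀ b x, 0 ≤ t₀ → ContinuousOn x (Icc (t₀ - r) b) → ∀ t ∈ Icc t₀ b, t ∉ A →
        ContinuousWithinAt (fun s => f s (fun θ => x (s + θ)) (d s)) (Icc t₀ b) t := by
  obtain ⟨A, hA, hc, -⟩ := h3
  obtain ⟨hdD, -, A', hA', hdc⟩ := hd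
  refine ⟨A ∪ A', fun C => by rw [union_inter_distrib_right]; exact (hA C).union (hA' C), ?_⟩
  intro t₀ b x ht₀ hx t ht htA
  rw [mem_union, not_or] at htA
  have ht' : 0 ≤ t := ht₀.trans ht.1
  refine Metric.continuousWithinAt_iff.2 fun ε hε => ?_
  obtain ⟨δ, hδ, H⟩ := hc t _ (d t) ht' htA.1 (continuousOn_history hx ht) (hdD t ht') ε hε
  obtain ⟨δ₁, hδ₁, H₁⟩ := exists_histNorm_history_sub_lt hr hx hδ
  obtain ⟨δ₂, hδ₂, H₂⟩ := hdc t ht' htA.2 δ hδ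
  refine ⟨min δ (min δ₁ δ₂), by positivity, fun s hs hst => ?_⟩
  simp only [Real.dist_eq, lt_min_iff] at hst
  have hs' : 0 ≤ s := ht₀.trans hs.1
  rw [dist_eq_norm]
  exact H s _ _ hs' (continuousOn_history hx hs) (hdD s hs') hst.1 (H₁ t ht s hs hst.2.1)
    (H₂ s hs' hst.2.2)

theorem H3.aestronglyMeasurable_along (hr : 0 ≤ r) (h3 : H3 n l r D f) {d : ℝ → Euc l}
    (hd : MD l D d) {t₀ b : ℝ} (ht₀ : 0 ≤ t₀) {x : ℝ → Euc n}
    (hx : ContinuousOn x (Icc (t₀ - r) b)) :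
    AEStronglyMeasurable (fun s => f s (fun θ => x (s + θ)) (d s))
      (volume.restrict (Icc t₀ b)) := by
  obtain ⟨A, hA, hc⟩ := h3.exists_continuous_along hr hd
  have hcont : ContinuousOn (fun s => f s (fun θ => x (s + θ)) (d s))
      (Icc t₀ b \ (A ∩ Icc 0 b)) := fun t ht =>
    (hc t₀ b x ht₀ hx t ht.1 fun htA => ht.2 ⟨htA, ht₀.trans ht.1.1, ht.1.2⟩).mono sdiff_subset
  have hmeas := hcont.aestronglyMeasurable (μ := volume)
    (measurableSet_Icc.diff (hA b).measurableSet)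
  rwa [Measure.restrict_congr_set
    (sdiff_null_ae_eq_self ((hA b).measure_zero volume))] at hmeas

/-- A right-hand side satisfying (H3) is integrable along curves on which it is bounded. -/
theorem H3.intervalIntegrable_along (hr : 0 ≤ r) (h3 : H3 n l r D f) {d : ℝ → Euc l}
    (hd : MD l D d) {t₀ b C : ℝ} (ht₀ : 0 ≤ t₀) (htb : t₀ ≤ b) {x : ℝ → Euc n}
    (hx : ContinuousOn x (Icc (t₀ - r) b))
    (hC : ∀ s ∈ Icc t₀ b, ‖f s (fun θ => x (s + θ)) (d s)‖ ≤ C) :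
    IntervalIntegrable (fun s => f s (fun θ => x (s + θ)) (d s)) volume t₀ b := by
  rw [intervalIntegrable_iff_integrableOn_Icc_of_le htb]
  exact Integrable.of_bound (h3.aestronglyMeasurable_along hr hd ht₀ hx) C
    ((ae_restrict_iff' measurableSet_Icc).2 (Eventually.of_forall hC))

end RightHandSide

section Decay

theorem le_mul_exp_of_slope_lt {W : ℝ → ℝ} {a b : ℝ} (hab : a ≤ b)
    (hW : ContinuousOn W (Icc a b))
    (hslope : ∀ t ∈ Ico a b, ∀ c, -W t < c → ∃ᶠ z in 𝓝[>] t, slope W t z < c) :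
    W b ≤ W a * Real.exp (-(b - a)) := by
  have key : ∀ ε > 0, W b ≤ W a * Real.exp (-(b - a)) + ε * (1 + (b - a)) := by
    intro ε hε
    have hderiv : ∀ t, HasDerivAt (fun t => W a * Real.exp (-(t - a)) + ε * (1 + (t - a)))
        (-(W a * Real.exp (-(t - a))) + ε) t := by
      intro t
      have h₁ : HasDerivAt (fun t : ℝ => t - a) 1 t := (hasDerivAt_id t).sub_const a
      exact (((h₁.fun_neg.exp).const_mul (W a)).fun_add ((h₁.const_add 1).const_mul ε)).congr_deriv
        (by ring)
    refine image_le_of_liminf_slope_right_lt_deriv_boundary' (f' := fun t => -W t) hW hslope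
      (B := fun t => W a * Real.exp (-(t - a)) + ε * (1 + (t - a)))
      (B' := fun t => -(W a * Real.exp (-(t - a))) + ε) (by simp [hε.le])
      (fun t _ => (hderiv t).continuousAt.continuousWithinAt)
      (fun t _ => (hderiv t).hasDerivWithinAt) ?_ (right_mem_Icc.2 hab)
    intro t ht heq
    simp only [heq]
    nlinarith [ht.1]
  have hlim : Tendsto (fun ε : ℝ => W a * Real.exp (-(b - a)) + ε * (1 + (b - a))) (𝓝[>] 0)
      (𝓝 (W a * Real.exp (-(b - a)) + 0 * (1 + (b - a)))) :=
    tendsto_nhdsWithin_of_tendsto_nhds (Continuous.tendsto (by fun_prop) 0)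
  rw [zero_mul, add_zero] at hlim
  exact ge_of_tendsto hlim (eventually_mem_nhdsWithin.mono key)

/-- A continuous function whose upper right derivative is at most `-W`, except at finitely many
points, decays exponentially. -/
theorem le_mul_exp_of_slope_lt_off_finite {W : ℝ → ℝ} {F : Set ℝ} (hF : F.Finite) :
    ∀ {a b : ℝ}, a ≤ b → ContinuousOn W (Icc a b) →
      (∀ t ∈ Ico a b, t ∉ F → ∀ c, -W t < c → ∃ᶠ z in 𝓝[>] t, slope W t z < c) →
      W b ≤ W a * Real.exp (-(b - a)) := by
  induction F, hF using Set.Finite.induction_on with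
  | empty =>
    intro a b hab hW h
    exact le_mul_exp_of_slope_lt hab hW fun t ht => h t ht (notMem_empty t)
  | @insert p F _ _ ih =>
    intro a b hab hW h
    have right : ∀ a', a ≤ a' → a' ≤ b → p < a' → W b ≤ W a' * Real.exp (-(b - a')) := by
      intro a' ha' hb hp
      refine ih hb (hW.mono (Icc_subset_Icc_left ha')) fun t ht htF => ?_
      refine h t ⟨ha'.trans ht.1, ht.2⟩ ?_
      rintro (rfl | h')
      · linarith [ht.1]
      · exact htF h'
    have right' : ∀ a', a ≤ a' → a' ≤ b → p ≤ a' → W b ≤ W a' * Real.exp (-(b - a')) := by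
      intro a' ha' hb hp
      rcases hb.eq_or_lt with rfl | hb
      · simp
      have hc : ContinuousWithinAt (fun s => W s * Real.exp (-(b - s))) (Ioo a' b) a' :=
        ((hW a' ⟨ha', hb.le⟩).mono
          (Ioo_subset_Icc_self.trans (Icc_subset_Icc_left ha'))).mul
          (Continuous.continuousWithinAt (by fun_prop))
      have : NeBot (𝓝[Ioo a' b] a') := left_nhdsWithin_Ioo_neBot hb
      exact ge_of_tendsto hc (eventually_mem_nhdsWithin.mono fun s hs =>
        right s (ha'.trans hs.1.le) hs.2.le (hp.trans_lt hs.1))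
    have left : ∀ b', a ≤ b' → b' ≤ b → b' ≤ p → W b' ≤ W a * Real.exp (-(b' - a)) := by
      intro b' ha hb' hp
      refine ih ha (hW.mono (Icc_subset_Icc_right hb')) fun t ht htF => ?_
      refine h t ⟨ht.1, ht.2.trans_le hb'⟩ ?_
      rintro (rfl | h')
      · linarith [ht.2]
      · exact htF h'
    rcases le_total b p with hbp | hpb
    · exact left b hab le_rfl hbp
    rcases le_total p a with hpa | hap
    · exact right' a le_rfl hab hpa
    calc W b ≤ W p * Real.exp (-(b - p)) := right' p hap hpb le_rfl
      _ ≤ W a * Real.exp (-(p - a)) * Real.exp (-(b - p)) := by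
        gcongr
        exact left p hap hpb le_rfl
      _ = W a * Real.exp (-(b - a)) := by
        rw [mul_assoc, ← Real.exp_add]
        ring_nf

end Decay

section Lyapunov

variable {n l : ℕ} {r : ℝ}

theorem Eop_eq (x : ℝ → Euc n) (h : ℝ) (v : Euc n) :
    Eop n x h v = fun θ => x (min (θ + h) 0) + max (θ + h) 0 • v := by
  funext θ
  unfold Eop
  split_ifs with hθ
  · rw [min_eq_right (by linarith), max_eq_left (by linarith)]
  · rw [min_eq_left (by linarith), max_eq_right (by linarith), zero_smul, add_zero]

theorem continuousOn_Eop (hr : 0 ≤ r) {x : ℝ → Euc n} (hx : ContinuousOn x (Icc (-r) 0)) {h : ℝ}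
    (hh : 0 ≤ h) (v : Euc n) : ContinuousOn (Eop n x h v) (Icc (-r) 0) := by
  rw [Eop_eq]
  refine (hx.comp (by fun_prop) fun θ hθ => ⟨le_min ?_ ?_, min_le_right _ _⟩).add (by fun_prop)
  · linarith [hθ.1]
  · linarith

/-- If `x` has right derivative `v` at `t`, then `Vdot` dominates the upper right derivative of
`V` along the history segments of `x`. -/
theorem eventually_slope_lt_of_Vdot_lt (hr : 0 ≤ r) {V : ℝ → (ℝ → Euc n) → ℝ} {x : ℝ → Euc n}
    {t₀ b t : ℝ} (hx : ContinuousOn x (Icc (t₀ - r) b)) (ht : t ∈ Ico t₀ b) {v : Euc n}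
    (hv : HasDerivWithinAt x v (Icc t b) t) {c : ℝ}
    (hc : Vdot n r V t (fun θ => x (t + θ)) v < (c : EReal)) :
    ∀ᶠ z in 𝓝[>] t, slope (fun s => V s (fun θ => x (s + θ))) t z < c := by
  obtain ⟨⟨δ, hδ⟩, hlt⟩ := iInf_lt_iff.1 hc
  rw [mem_Ioi] at hδ
  have hsmall := hv.isLittleO.def (c := δ / 2) (by positivity)
  rw [eventually_nhdsWithin_iff, Metric.eventually_nhds_iff] at hsmall
  obtain ⟨η, hη, hsmall⟩ := hsmall
  have hmem : Ioo t (min b (t + min δ η)) ∈ 𝓝[>] t :=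
    Ioo_mem_nhdsGT (lt_min ht.2 (by simp [hδ, hη]))
  filter_upwards [hmem] with z hz
  have hzb : z < b := hz.2.trans_le (min_le_left _ _)
  have hzδ : z < t + δ :=
    hz.2.trans_le ((min_le_right _ _).trans (by gcongr; exact min_le_left _ _))
  have hzη : z < t + η :=
    hz.2.trans_le ((min_le_right _ _).trans (by gcongr; exact min_le_right _ _))
  have htb : t ∈ Icc t₀ b := ⟨ht.1, ht.2.le⟩
  have hh : 0 < z - t := sub_pos.2 hz.1
  set y : ℝ → Euc n := fun θ =>
    (z - t)⁻¹ • (x (z + θ) - Eop n (fun θ => x (t + θ)) (z - t) v θ) with hy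
  have hycont : ContinuousOn y (Icc (-r) 0) :=
    continuousOn_const.fun_smul ((continuousOn_history hx ⟨ht.1.trans hz.1.le, hzb.le⟩).fun_sub
      (continuousOn_Eop hr (continuousOn_history hx htb) hh.le v))
  have hynorm : histNorm n r y < δ := by
    refine (histNorm_le hr (c := δ / 2) fun θ hθ => ?_).trans_lt (by linarith)
    rw [hy, norm_smul, norm_inv, Real.norm_of_nonneg hh.le, inv_mul_le_iff₀ hh]
    unfold Eop
    beta_reduce
    split_ifs with hθz
    · have := hsmall (y := z + θ)
        (by rw [Real.dist_eq, abs_lt]; constructor <;> linarith [hθ.2])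
        ⟨by linarith, by linarith [hθ.2]⟩
      simp only [Real.norm_eq_abs, abs_of_pos (show 0 < z + θ - t by linarith)] at this
      rw [add_zero, show θ + (z - t) = z + θ - t by ring, ← sub_sub]
      refine this.trans ?_
      rw [mul_comm]
      gcongr
      linarith [hθ.2]
    · rw [show t + (θ + (z - t)) = z + θ by ring, sub_self, norm_zero]
      positivity
  have hle := (le_iSup (fun p : {p : ℝ × (ℝ → Euc n) //
      0 < p.1 ∧ p.1 < δ ∧ ContinuousOn p.2 (Icc (-r) 0) ∧ histNorm n r p.2 < δ} =>
    (((V (t + p.1.1) (fun θ => Eop n (fun θ => x (t + θ)) p.1.1 v θ + p.1.1 • p.1.2 θ) -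
      V t (fun θ => x (t + θ))) / p.1.1 : ℝ) : EReal))
    ⟨(z - t, y), hh, by linarith, hycont, hynorm⟩).trans_lt hlt
  rw [EReal.coe_lt_coe_iff] at hle
  convert hle using 1
  simp only [slope_def_field, hy, smul_inv_smul₀ hh.ne', add_sub_cancel]

variable {D : Set (Euc l)} {f : ℝ → (ℝ → Euc n) → Euc l → Euc n}

/-- A Lyapunov functional decays exponentially along solutions on a compact interval. -/
theorem lyapunov_le_mul_exp (hr : 0 ≤ r) (h3 : H3 n l r D f) {V : ℝ → (ℝ → Euc n) → ℝ}
    (hVcont : ∀ t x, 0 ≤ t → ContinuousOn x (Icc (-r) 0) → ∀ ε > 0, ∃ δ > 0,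
      ∀ t' x', 0 ≤ t' → ContinuousOn x' (Icc (-r) 0) →
        |t' - t| + histNorm n r (x' - x) < δ → |V t' x' - V t x| < ε)
    (hdecr : ∀ t x d, 0 ≤ t → ContinuousOn x (Icc (-r) 0) → d ∈ D →
      Vdot n r V t x (f t x d) ≤ ((-(V t x) : ℝ) : EReal))
    {d : ℝ → Euc l} (hd : MD l D d) {t₀ b : ℝ} (ht₀ : 0 ≤ t₀) (htb : t₀ ≤ b) {x : ℝ → Euc n}
    (hx : ContinuousOn x (Icc (t₀ - r) b))
    (hint : IntervalIntegrable (fun s => f s (fun θ => x (s + θ)) (d s)) volume t₀ b)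
    (hsol : ∀ t ∈ Icc t₀ b, x t = x t₀ + ∫ s in t₀..t, f s (fun θ => x (s + θ)) (d s)) :
    V b (fun θ => x (b + θ)) ≤ V t₀ (fun θ => x (t₀ + θ)) * Real.exp (-(b - t₀)) := by
  obtain ⟨A, hA, hc⟩ := h3.exists_continuous_along hr hd
  refine le_mul_exp_of_slope_lt_off_finite (W := fun s => V s (fun θ => x (s + θ))) (hA b) htb
    ?_ ?_
  · intro t ht
    refine Metric.continuousWithinAt_iff.2 fun ε hε => ?_
    obtain ⟨δ, hδ, H⟩ := hVcont t _ (ht₀.trans ht.1) (continuousOn_history hx ht) ε hε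
    obtain ⟨δ₁, hδ₁, H₁⟩ := exists_histNorm_history_sub_lt hr hx (half_pos hδ)
    refine ⟨min (δ / 2) δ₁, by positivity, fun s hs hst => ?_⟩
    rw [Real.dist_eq, lt_min_iff] at hst
    exact H s _ (ht₀.trans hs.1) (continuousOn_history hx hs)
      (by linarith [H₁ t ht s hs hst.2])
  · intro t ht htA c hcW
    have ht' : t ∈ Icc t₀ b := ⟨ht.1, ht.2.le⟩
    have hderiv : HasDerivWithinAt x (f t (fun θ => x (t + θ)) (d t)) (Icc t b) t := by
      have hcont := hc t₀ b x ht₀ hx t ht' fun h => htA ⟨h, ht₀.trans ht.1, ht.2.le⟩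
      have hFTC : HasDerivWithinAt
          (fun u => ∫ s in t₀..u, f s (fun θ => x (s + θ)) (d s))
          (f t (fun θ => x (t + θ)) (d t)) (Ici t) t := by
        refine intervalIntegral.integral_hasDerivWithinAt_right (t := Ioi t)
          (hint.mono_set ?_) ?_ ?_
        · rw [uIcc_of_le ht.1, uIcc_of_le htb]
          exact Icc_subset_Icc_right ht.2.le
        · refine ⟨Ioc t b, Ioc_mem_nhdsGT ht.2, ?_⟩
          refine (h3.aestronglyMeasurable_along hr hd ht₀ hx).mono_set ?_
          exact Ioc_subset_Icc_self.trans (Icc_subset_Icc_left ht.1)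
        · refine hcont.mono_of_mem_nhdsWithin ?_
          exact mem_of_superset (Ioc_mem_nhdsGT ht.2)
            (Ioc_subset_Icc_self.trans (Icc_subset_Icc_left ht.1))
      refine ((hFTC.const_add (x t₀)).mono Icc_subset_Ici_self).congr_of_mem ?_
        (left_mem_Icc.2 ht.2.le)
      exact fun s hs => hsol s ⟨ht.1.trans hs.1, hs.2⟩
    refine (eventually_slope_lt_of_Vdot_lt hr hx ht hderiv ?_).frequently
    refine (hdecr t _ _ (ht₀.trans ht.1) (continuousOn_history hx ht')
      (hd.1 t (ht₀.trans ht.1))).trans_lt ?_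
    exact_mod_cast hcW

end Lyapunov

section Existence

/-- Diagonal form of the Arzelà-Ascoli theorem for uniformly locally Lipschitz functions which
vanish on `(-∞, t₀]`. -/
theorem exists_uniform_limit_of_lipschitz {E : Type*} [NormedAddCommGroup E] [ProperSpace E]
    {w : ℕ → ℝ → E} {t₀ : ℝ} {C : ℝ → ℝ} (hC : ∀ T, 0 ≤ C T)
    (hw₀ : ∀ k, ∀ t ≤ t₀, w k t = 0)
    (hw : ∀ k T, ∀ s ≤ T, ∀ t ≤ T, ‖w k t - w k s‖ ≤ C T * |t - s|) :
    ∃ (u : ℝ → E) (κ : ℕ → ℕ), Continuous u ∧ (∀ t ≤ t₀, u t = 0) ∧ (∀ m, m ≤ κ m) ∧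
      ∀ T, ∀ ε > 0, ∀ᶠ m in atTop, ∀ t ≤ T, ‖w (κ m) t - u t‖ ≤ ε := by
  have hlim : ∀ t, ∃ a, Tendsto (fun k => w k t) (hyperfilter ℕ) (𝓝 a) := by
    intro t
    obtain ⟨a, -, ha⟩ := (isCompact_closedBall (0 : E)
      (C (max t t₀) * |t - t₀|)).ultrafilter_le_nhds ((hyperfilter ℕ).map fun k => w k t) (by
        rw [le_principal_iff, Ultrafilter.mem_coe, Ultrafilter.mem_map]
        refine univ_mem' fun k => ?_
        simpa [hw₀ k t₀ le_rfl] using hw k (max t t₀) t₀ (le_max_right _ _) t (le_max_left _ _))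
    exact ⟨a, ha⟩
  choose u hu using hlim
  have hulip : ∀ T, ∀ s ≤ T, ∀ t ≤ T, ‖u t - u s‖ ≤ C T * |t - s| := fun T s hs t ht =>
    le_of_tendsto ((hu t).sub (hu s)).norm (Eventually.of_forall fun k => hw k T s hs t ht)
  have hu₀ : ∀ t ≤ t₀, u t = 0 := fun t ht =>
    tendsto_nhds_unique (hu t) (by simp only [hw₀ _ t ht]; exact tendsto_const_nhds)
  have hucont : Continuous u := by
    refine continuous_iff_continuousAt.2 fun t => ?_
    have hlip : LipschitzOnWith (C (t + 1)).toNNReal u (Iic (t + 1)) :=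
      LipschitzOnWith.of_dist_le_mul fun a ha b hb => by
        rw [dist_eq_norm, Real.dist_eq, Real.coe_toNNReal _ (hC _)]
        exact hulip _ b hb a ha
    exact hlip.continuousOn.continuousAt (Iic_mem_nhds (by linarith))
  have hunif : ∀ T, ∀ ε > 0, ∀ᶠ k in (hyperfilter ℕ : Filter ℕ), ∀ t ≤ T,
      ‖w k t - u t‖ ≤ ε := by
    intro T ε hε
    have hη : 0 < ε / (3 * (C T + 1)) := div_pos hε (by linarith [hC T])
    have hηC : C T * (ε / (3 * (C T + 1))) ≤ ε / 3 := by
      have := hC T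
      rw [mul_div_assoc', div_le_div_iff₀ (by positivity) (by positivity)]
      nlinarith
    obtain ⟨F, hFsub, hFfin, hF⟩ :=
      (isCompact_Icc (a := t₀) (b := T)).finite_cover_balls hη
    have hev : ∀ᶠ k in (hyperfilter ℕ : Filter ℕ), ∀ p ∈ F, ‖w k p - u p‖ < ε / 3 := by
      refine (eventually_all_finite hFfin).2 fun p _ => ?_
      have := (hu p).eventually (Metric.ball_mem_nhds (u p) (by positivity : 0 < ε / 3))
      simpa [dist_eq_norm] using this
    filter_upwards [hev] with k hk t ht
    rcases le_total t t₀ with htt | htt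
    · simp [hw₀ k t htt, hu₀ t htt, hε.le]
    obtain ⟨p, hp, htp⟩ := mem_iUnion₂.1 (hF ⟨htt, ht⟩)
    rw [Metric.mem_ball, Real.dist_eq] at htp
    have hpT : p ≤ T := (hFsub hp).2
    have hstep : C T * |t - p| ≤ ε / 3 :=
      (mul_le_mul_of_nonneg_left htp.le (hC T)).trans hηC
    calc ‖w k t - u t‖ = ‖(w k t - w k p) + (w k p - u p) - (u t - u p)‖ := by
          congr 1; abel
      _ ≤ ‖w k t - w k p‖ + ‖w k p - u p‖ + ‖u t - u p‖ :=
          (norm_sub_le _ _).trans (by gcongr; exact norm_add_le _ _)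
      _ ≤ ε := by
          linarith [hw k T p hpT t ht, hulip T p hpT t ht, hk p hp]
  have hchoose : ∀ m : ℕ, ∃ k, m ≤ k ∧ ∀ t ≤ (m : ℝ), ‖w k t - u t‖ ≤ 1 / ((m : ℝ) + 1) :=
    fun m => (((eventually_ge_atTop m).filter_mono Nat.hyperfilter_le_atTop).and
      (hunif m _ (by positivity))).exists
  choose κ hκ using hchoose
  refine ⟨u, κ, hucont, hu₀, fun m => (hκ m).1, fun T ε hε => ?_⟩
  have hsmall := tendsto_one_div_add_atTop_nhds_zero_nat.eventually (ge_mem_nhds hε)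
  filter_upwards [hsmall, eventually_ge_atTop ⌈T⌉₊] with m hm hmT t ht
  exact ((hκ m).2 t (ht.trans ((Nat.le_ceil T).trans (by exact_mod_cast hmT)))).trans hm

variable {n l : ℕ} {r : ℝ} {D : Set (Euc l)} {g : ℝ → (ℝ → Euc n) → Euc l → Euc n}
  {d : ℝ → Euc l} {t₀ h : ℝ} {φ z : ℝ → Euc n} {C : ℝ → ℝ}

/-- The Picard operator with initial function `φ` for the equation whose right-hand side is
evaluated along histories delayed by `h`. -/
def delayedPicard (g : ℝ → (ℝ → Euc n) → Euc l → Euc n) (d : ℝ → Euc l) (t₀ h : ℝ)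
    (φ z : ℝ → Euc n) : ℝ → Euc n :=
  fun t => φ t + ∫ s in t₀..max t t₀, g s (fun θ => z (s + θ - h)) (d s)

theorem delayedPicard_of_le {t : ℝ} (ht : t ≤ t₀) : delayedPicard g d t₀ h φ z t = φ t := by
  simp [delayedPicard, max_eq_right ht]

theorem intervalIntegrable_delayed (hr : 0 ≤ r) (h3 : H3 n l r D g)
    (hgC : ∀ T, ∀ t x e, 0 ≤ t → t ≤ T → ContinuousOn x (Icc (-r) 0) → e ∈ D → ‖g t x e‖ ≤ C T)
    (hd : MD l D d) (ht₀ : 0 ≤ t₀) (hz : Continuous z) {t : ℝ} (ht : t₀ ≤ t) :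
    IntervalIntegrable (fun s => g s (fun θ => z (s + θ - h)) (d s)) volume t₀ t :=
  h3.intervalIntegrable_along hr hd (x := fun u => z (u - h)) (C := C t) ht₀ ht
    (Continuous.continuousOn (by fun_prop)) fun s hs =>
      hgC t s _ _ (ht₀.trans hs.1) hs.2 (Continuous.continuousOn (by fun_prop))
        (hd.1 s (ht₀.trans hs.1))

theorem norm_delayedPicard_sub_le (hr : 0 ≤ r) (h3 : H3 n l r D g) (hC : ∀ T, 0 ≤ C T)
    (hgC : ∀ T, ∀ t x e, 0 ≤ t → t ≤ T → ContinuousOn x (Icc (-r) 0) → e ∈ D → ‖g t x e‖ ≤ C T)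
    (hd : MD l D d) (ht₀ : 0 ≤ t₀) (hz : Continuous z) {T s t : ℝ} (hs : s ≤ T) (ht : t ≤ T) :
    ‖(delayedPicard g d t₀ h φ z t - φ t) - (delayedPicard g d t₀ h φ z s - φ s)‖ ≤
      C T * |t - s| := by
  simp only [delayedPicard, add_sub_cancel_left]
  rw [intervalIntegral.integral_interval_sub_left
    (intervalIntegrable_delayed hr h3 hgC hd ht₀ hz (le_max_right _ _))
    (intervalIntegrable_delayed hr h3 hgC hd ht₀ hz (le_max_right _ _))]
  rcases le_total T t₀ with hT | hT
  · rw [max_eq_right (ht.trans hT), max_eq_right (hs.trans hT), intervalIntegral.integral_same,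
      norm_zero]
    exact mul_nonneg (hC T) (abs_nonneg _)
  · refine (intervalIntegral.norm_integral_le_of_norm_le_const (C := C T) fun u hu => ?_).trans
      (mul_le_mul_of_nonneg_left (abs_max_sub_max_le_abs _ _ _) (hC T))
    rw [uIoc, mem_Ioc] at hu
    have hu₀ : 0 ≤ u := ht₀.trans ((le_min (le_max_right _ _) (le_max_right _ _)).trans hu.1.le)
    exact hgC T u _ _ hu₀ (hu.2.trans (max_le (max_le hs hT) (max_le ht hT)))
      (Continuous.continuousOn (by fun_prop)) (hd.1 u hu₀)

theorem continuous_delayedPicard (hr : 0 ≤ r) (h3 : H3 n l r D g) (hC : ∀ T, 0 ≤ C T)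
    (hgC : ∀ T, ∀ t x e, 0 ≤ t → t ≤ T → ContinuousOn x (Icc (-r) 0) → e ∈ D → ‖g t x e‖ ≤ C T)
    (hd : MD l D d) (ht₀ : 0 ≤ t₀) (hφ : Continuous φ) (hz : Continuous z) :
    Continuous (delayedPicard g d t₀ h φ z) := by
  have hsub : Continuous fun t => delayedPicard g d t₀ h φ z t - φ t := by
    refine continuous_iff_continuousAt.2 fun t => ?_
    have hlip : LipschitzOnWith (C (t + 1)).toNNReal
        (fun t => delayedPicard g d t₀ h φ z t - φ t) (Iic (t + 1)) :=
      LipschitzOnWith.of_dist_le_mul fun a ha b hb => by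
        rw [dist_eq_norm, Real.dist_eq, Real.coe_toNNReal _ (hC _)]
        exact norm_delayedPicard_sub_le hr h3 hC hgC hd ht₀ hz hb ha
    exact hlip.continuousOn.continuousAt (Iic_mem_nhds (by linarith))
  simpa using hsub.fun_add hφ

/-- Solutions of the equation with an additional delay `h > 0`, obtained by the method of
steps. -/
theorem exists_delayed_solution (hr : 0 ≤ r) (h3 : H3 n l r D g) (hC : ∀ T, 0 ≤ C T)
    (hgC : ∀ T, ∀ t x e, 0 ≤ t → t ≤ T → ContinuousOn x (Icc (-r) 0) → e ∈ D → ‖g t x e‖ ≤ C T)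
    (hd : MD l D d) (ht₀ : 0 ≤ t₀) (hφ : Continuous φ) (hh : 0 < h) (T : ℝ) :
    ∃ z, Continuous z ∧ (∀ t ≤ t₀, z t = φ t) ∧
      (∀ b, ∀ s ≤ b, ∀ t ≤ b, ‖(z t - φ t) - (z s - φ s)‖ ≤ C b * |t - s|) ∧
      ∀ t ≤ T, z t = delayedPicard g d t₀ h φ z t := by
  set Φ := delayedPicard g d t₀ h φ
  have hcont : ∀ m, Continuous (Φ^[m] φ) := by
    intro m
    induction m with
    | zero => exact hφ
    | succ m ih =>
      rw [Function.iterate_succ_apply']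
      exact continuous_delayedPicard hr h3 hC hgC hd ht₀ hφ ih
  have hstep : ∀ m : ℕ, ∀ t ≤ t₀ + m * h, Φ^[m + 1] φ t = Φ^[m] φ t := by
    intro m
    induction m with
    | zero =>
      intro t ht
      exact delayedPicard_of_le (by simpa using ht)
    | succ m ih =>
      intro t ht
      rw [Function.iterate_succ_apply' Φ (m + 1), Function.iterate_succ_apply' Φ m]
      change φ t + _ = φ t + _
      rw [← Function.iterate_succ_apply' Φ m]
      congr 1
      refine intervalIntegral.integral_congr fun s hs => ?_
      rw [uIcc_of_le (le_max_right _ _)] at hs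
      have hs₀ : 0 ≤ s := ht₀.trans hs.1
      have hcs : Continuous fun θ => Φ^[m + 1] φ (s + θ - h) :=
        (hcont (m + 1)).comp (by fun_prop)
      refine h3.congr hr hs₀ (hd.1 s hs₀) hcs.continuousOn fun θ hθ => ih _ ?_
      have hmh : 0 ≤ (m : ℝ) * h := by positivity
      push_cast at ht
      have := hs.2.trans (max_le ht (by linarith))
      linarith [hθ.2]
  obtain ⟨m, hm⟩ := exists_nat_gt ((T - t₀) / h)
  rw [div_lt_iff₀ hh] at hm
  refine ⟨Φ^[m + 1] φ, hcont _, fun t ht => ?_, fun b s hs t ht => ?_, fun t ht => ?_⟩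
  · rw [Function.iterate_succ_apply']
    exact delayedPicard_of_le ht
  · rw [Function.iterate_succ_apply']
    exact norm_delayedPicard_sub_le hr h3 hC hgC hd ht₀ (hcont m) hs ht
  · rw [← hstep (m + 1) t (by push_cast; linarith), Function.iterate_succ_apply' Φ (m + 1)]

/-- Global existence for a right-hand side that is bounded on bounded time intervals. -/
theorem exists_isSolGlobal_of_bounded (hr : 0 ≤ r) (h3 : H3 n l r D g)
    (hg : ∀ T, ∃ C, ∀ t x e, 0 ≤ t → t ≤ T → ContinuousOn x (Icc (-r) 0) → e ∈ D →
      ‖g t x e‖ ≤ C)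
    (hd : MD l D d) (ht₀ : 0 ≤ t₀) {x₀ : ℝ → Euc n} (hx₀ : ContinuousOn x₀ (Icc (-r) 0)) :
    ∃ x, Continuous x ∧ IsSolGlobal n l r g d t₀ x ∧ ∀ θ ∈ Icc (-r) 0, x (t₀ + θ) = x₀ θ := by
  obtain ⟨C, hC, hgC⟩ : ∃ C : ℝ → ℝ, (∀ T, 0 ≤ C T) ∧ ∀ T, ∀ t x e, 0 ≤ t → t ≤ T →
      ContinuousOn x (Icc (-r) 0) → e ∈ D → ‖g t x e‖ ≤ C T := by
    choose C hC using hg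
    exact ⟨fun T => |C T|, fun T => abs_nonneg _, fun T t x e h₁ h₂ h₃ h₄ =>
      (hC T t x e h₁ h₂ h₃ h₄).trans (le_abs_self _)⟩
  set φ : ℝ → Euc n := fun t => x₀ (max (-r) (min 0 (t - t₀))) with hφdef
  have hφ : Continuous φ := hx₀.comp_continuous (by fun_prop) fun t =>
    ⟨le_max_left _ _, max_le (by linarith) (min_le_left _ _)⟩
  have hφ₀ : ∀ t, t₀ ≤ t → φ t = x₀ 0 := fun t ht => by
    rw [hφdef]
    simp only
    rw [min_eq_left (by linarith), max_eq_right (by linarith)]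
  have hφhist : ∀ θ ∈ Icc (-r) 0, φ (t₀ + θ) = x₀ θ := fun θ hθ => by
    rw [hφdef]
    simp only
    rw [add_sub_cancel_left, min_eq_right hθ.2, max_eq_right hθ.1]
  choose z hzc hz₀ hzlip hzeq using fun k : ℕ =>
    exists_delayed_solution (h := 1 / ((k : ℝ) + 1)) hr h3 hC hgC hd ht₀ hφ (by positivity) k
  obtain ⟨u, κ, huc, hu₀, hκ, hlim⟩ := exists_uniform_limit_of_lipschitz
    (w := fun k t => z k t - φ t) (t₀ := t₀) hC (fun k t ht => by simp [hz₀ k t ht]) hzlip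
  set x : ℝ → Euc n := fun t => φ t + u t with hxdef
  have hxc : Continuous x := hφ.add huc
  have hxt₀ : x t₀ = x₀ 0 := by rw [hxdef]; simp [hu₀ t₀ le_rfl, hφ₀ t₀ le_rfl]
  have hzx : ∀ T, ∀ ε > 0, ∀ᶠ m in atTop, ∀ t ≤ T, ‖z (κ m) t - x t‖ ≤ ε := by
    intro T ε hε
    filter_upwards [hlim T ε hε] with m hm t ht
    rw [hxdef]
    simpa [sub_sub] using hm t ht
  have hpoint : ∀ t, Tendsto (fun m => z (κ m) t) atTop (𝓝 (x t)) := fun t =>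
    Metric.tendsto_atTop'.2 fun ε hε => by
      obtain ⟨N, hN⟩ := eventually_atTop.1 (hzx t (ε / 2) (by positivity))
      exact ⟨N, fun m hm => by
        rw [dist_eq_norm]; linarith [hN m hm.le t le_rfl]⟩
  have hdelay : Tendsto (fun m => 1 / ((κ m : ℝ) + 1)) atTop (𝓝 0) :=
    tendsto_one_div_add_atTop_nhds_zero_nat.comp (tendsto_atTop_mono hκ tendsto_id)
  have hint : ∀ t, t₀ ≤ t →
      IntervalIntegrable (fun s => g s (fun θ => x (s + θ)) (d s)) volume t₀ t := fun t ht => by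
    simpa using intervalIntegrable_delayed (h := 0) hr h3 hgC hd ht₀ hxc ht
  refine ⟨x, hxc, ⟨hxc.continuousOn, fun t ht => ⟨hint t ht, ?_⟩⟩, fun θ hθ => ?_⟩
  swap
  · rw [hxdef]
    simp [hu₀ (t₀ + θ) (by linarith [hθ.2]), hφhist θ hθ]
  obtain ⟨A, hA, hgcont, -⟩ := id h3
  have hintlim : Tendsto
      (fun m => ∫ s in t₀..t, g s (fun θ => z (κ m) (s + θ - 1 / ((κ m : ℝ) + 1))) (d s)) atTop
      (𝓝 (∫ s in t₀..t, g s (fun θ => x (s + θ)) (d s))) := by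
    refine intervalIntegral.tendsto_integral_filter_of_dominated_convergence (fun _ => C t)
      (Eventually.of_forall fun m =>
        (intervalIntegrable_delayed hr h3 hgC hd ht₀ (hzc (κ m)) ht).def'.aestronglyMeasurable)
      (Eventually.of_forall fun m => Eventually.of_forall fun s hs => ?_)
      intervalIntegrable_const ?_
    · rw [uIoc_of_le ht] at hs
      have hs₀ : 0 ≤ s := ht₀.trans hs.1.le
      exact hgC t s _ _ hs₀ hs.2 ((hzc (κ m)).comp (by fun_prop)).continuousOn (hd.1 s hs₀)
    · have hnull : ∀ᵐ s ∂(volume : Measure ℝ), s ∉ A ∩ Icc 0 t :=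
        measure_eq_zero_iff_ae_notMem.1 ((hA t).measure_zero volume)
      filter_upwards [hnull] with s hsA hs
      rw [uIoc_of_le ht] at hs
      have hs₀ : 0 ≤ s := ht₀.trans hs.1.le
      have hsA' : s ∉ A := fun hA' => hsA ⟨hA', hs₀, hs.2⟩
      refine Metric.tendsto_atTop.2 fun ε hε => ?_
      rw [← eventually_atTop]
      have hxs : Continuous fun θ => x (s + θ) := hxc.comp (by fun_prop)
      obtain ⟨δ, hδ, H⟩ := hgcont s _ (d s) hs₀ hsA' hxs.continuousOn (hd.1 s hs₀) ε hε
      obtain ⟨η, hη, hxη⟩ := exists_histNorm_history_sub_lt (t₀ := s - 1) (b := s) hr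
        hxc.continuousOn (show 0 < δ / 3 by positivity)
      filter_upwards [hzx s (δ / 3) (by positivity), hdelay.eventually (gt_mem_nhds hη)]
        with m hm hmη
      have hpos : 0 < 1 / ((κ m : ℝ) + 1) := by positivity
      have hle1 : 1 / ((κ m : ℝ) + 1) ≤ 1 := by
        rw [div_le_one (by positivity)]
        linarith [(κ m).cast_nonneg (α := ℝ)]
      have hxm := hxη s ⟨by linarith, le_rfl⟩ (s - 1 / ((κ m : ℝ) + 1))
        ⟨by linarith, by linarith⟩
        (by rw [sub_sub_cancel_left, abs_neg, abs_of_pos hpos]; exact hmη)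
      rw [dist_eq_norm]
      refine H s _ _ hs₀ ((hzc (κ m)).comp (by fun_prop)).continuousOn (hd.1 s hs₀) (by simpa)
        ?_ (by simpa)
      refine (histNorm_le hr (c := δ / 3 + δ / 3) fun θ hθ => ?_).trans_lt (by linarith)
      have h₁ := hm (s + θ - 1 / ((κ m : ℝ) + 1)) (by linarith [hθ.2])
      have hcs : Continuous ((fun θ => x (s - 1 / ((κ m : ℝ) + 1) + θ)) - fun θ => x (s + θ)) :=
        (hxc.comp (by fun_prop)).sub hxs
      have h₂ := (norm_le_histNorm hcs.continuousOn hθ).trans hxm.le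
      simp only [Pi.sub_apply] at h₂ ⊢
      rw [show s - 1 / ((κ m : ℝ) + 1) + θ = s + θ - 1 / ((κ m : ℝ) + 1) by ring] at h₂
      exact (norm_sub_le_norm_sub_add_norm_sub _ (x (s + θ - 1 / ((κ m : ℝ) + 1))) _).trans
        (add_le_add h₁ h₂)
  refine tendsto_nhds_unique (hpoint t) ?_
  rw [hxt₀]
  refine (hintlim.const_add (x₀ 0)).congr' ?_
  filter_upwards [eventually_ge_atTop ⌈t⌉₊] with m hm
  have htκ : t ≤ κ m := (Nat.le_ceil t).trans (by exact_mod_cast hm.trans (hκ m))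
  rw [hzeq (κ m) t htκ, delayedPicard, max_eq_left ht, hφ₀ t ht]

end Existence

section Truncation

variable {n l : ℕ} {r : ℝ} {D : Set (Euc l)} {f : ℝ → (ℝ → Euc n) → Euc l → Euc n}

/-- The radial retraction onto the closed ball of radius `R`. -/
def ballRetract (R : ℝ) (v : Euc n) : Euc n := (R / max R ‖v‖) • v

theorem ballRetract_of_norm_le {R : ℝ} (hR : 0 < R) {v : Euc n} (hv : ‖v‖ ≤ R) :
    ballRetract R v = v := by
  rw [ballRetract, max_eq_left hv, div_self hR.ne', one_smul]

theorem norm_ballRetract_le {R : ℝ} (hR : 0 < R) (v : Euc n) : ‖ballRetract R v‖ ≤ R := by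
  have hpos : 0 < max R ‖v‖ := lt_max_of_lt_left hR
  rw [ballRetract, norm_smul, Real.norm_of_nonneg (by positivity), div_mul_eq_mul_div,
    div_le_iff₀ hpos]
  exact mul_le_mul_of_nonneg_left (le_max_right _ _) hR.le

theorem continuous_ballRetract {R : ℝ} (hR : 0 < R) :
    Continuous (ballRetract R : Euc n → Euc n) :=
  (continuous_const.div (by fun_prop) fun _ => (lt_max_of_lt_left hR).ne').smul continuous_id

/-- Composition with a continuous map preserves (H3). -/
theorem H3.comp_continuous (hr : 0 ≤ r) (h3 : H3 n l r D f) {P : Euc n → Euc n}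
    (hP : Continuous P) : H3 n l r D fun t x e => f t (fun θ => P (x θ)) e := by
  obtain ⟨A, hA, hc, hrc⟩ := h3
  refine ⟨A, hA, fun t x e ht htA hx he ε hε => ?_, fun t x e ht hx he ε hε =>
    hrc t _ e ht (hP.comp_continuousOn hx) he ε hε⟩
  obtain ⟨δ, hδ, H⟩ := hc t _ e ht htA (hP.comp_continuousOn hx) he ε hε
  have hunif := (isCompact_Icc.image_of_continuousOn hx).uniformContinuousAt_of_continuousAt P
    (fun a _ => hP.continuousAt) (Metric.dist_mem_uniformity (half_pos hδ))
  obtain ⟨η, hη, hPη⟩ := Metric.mem_uniformity_dist.1 hunif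
  refine ⟨min δ η, by positivity, fun t' x' e' ht' hx' he' h₁ h₂ h₃ => ?_⟩
  rw [lt_min_iff] at h₁ h₂ h₃
  refine H t' _ e' ht' (hP.comp_continuousOn hx') he' h₁.1 ?_ h₃.1
  refine (histNorm_le hr (c := δ / 2) fun θ hθ => ?_).trans_lt (by linarith)
  have hxθ : ‖x' θ - x θ‖ < η := (norm_le_histNorm (hx'.sub hx) hθ).trans_lt h₂.2
  have := hPη (a := x θ) (b := x' θ) (by rwa [dist_comm, dist_eq_norm]) ⟨θ, hθ, rfl⟩
  rw [mem_ofPred_eq, dist_comm, dist_eq_norm] at this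
  exact this.le

end Truncation

theorem IsKInf.exists_orderIso {a : ℝ → ℝ} (ha : IsKInf a) :
    ∃ e : ℝ ≃o ℝ, ∀ s, 0 ≤ s → e s = a s := by
  obtain ⟨hc, hmono, h0, hnn, hlim⟩ := ha
  set b : ℝ → ℝ := fun s => a (max s 0) + min s 0 with hb
  have hbpos : ∀ s, 0 ≤ s → b s = a s := fun s hs => by simp [hb, hs]
  have hbneg : ∀ s, s ≤ 0 → b s = s := fun s hs => by simp [hb, hs, h0]
  have hbmono : StrictMono b := by
    refine StrictMonoOn.Iic_union_Ici (a := 0) ?_ ?_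
    · exact strictMonoOn_id.congr fun s hs => (hbneg s hs).symm
    · exact hmono.congr fun s hs => (hbpos s hs).symm
  have hbc : Continuous b :=
    (hc.comp_continuous (by fun_prop) fun s => le_max_right s 0).add (by fun_prop)
  have hbtop : Tendsto b atTop atTop :=
    hlim.congr' ((eventually_ge_atTop 0).mono fun s hs => (hbpos s hs).symm)
  have hbbot : Tendsto b atBot atBot :=
    tendsto_id.congr' ((eventually_le_atBot 0).mono fun s hs => (hbneg s hs).symm)
  exact ⟨hbmono.orderIsoOfSurjective b (hbc.surjective hbtop hbbot), hbpos⟩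

theorem isKL_inverse_mul_exp {a₂ : ℝ → ℝ} (ha₂ : IsKInf a₂) (e : ℝ ≃o ℝ) (he : e 0 = 0) :
    IsKL fun s t => e.symm (a₂ s * Real.exp (-t)) := by
  obtain ⟨hc, hmono, h0, hnn, -⟩ := ha₂
  have he' : e.symm 0 = 0 := by rw [OrderIso.symm_apply_eq, he]
  refine ⟨?_, fun s t hs _ => ?_, fun t _ => ⟨fun s hs s' hs' hss => ?_, ?_⟩,
    fun s hs t _ t' _ htt => ?_, fun s _ => ?_⟩
  · refine e.symm.continuous.comp_continuousOn ?_
    exact (hc.comp continuousOn_fst fun p hp => hp.1).mul (by fun_prop)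
  · rw [← he']
    exact e.symm.monotone (mul_nonneg (hnn s hs) (Real.exp_pos _).le)
  · exact e.symm.strictMono (mul_lt_mul_of_pos_right (hmono hs hs' hss) (Real.exp_pos _))
  · simp [h0, he']
  · exact e.symm.monotone (mul_le_mul_of_nonneg_left (Real.exp_le_exp.2 (by linarith)) (hnn s hs))
  · have hlim : Tendsto (fun t : ℝ => a₂ s * Real.exp (-t)) atTop (𝓝 0) := by
      simpa using (Real.tendsto_exp_neg_atTop_nhds_zero).const_mul (a₂ s)
    have := (e.symm.continuous.tendsto 0).comp hlim
    rwa [he'] at this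

/-- **Theorem 2.10, (b) ⇒ (a).** Under hypotheses (H1)-(H4), the existence
of a continuous Lyapunov functional `V` with uniform bounds `a₁(‖x‖_r) ≤ V(t,x) ≤ a₂(‖x‖_r)`,
the infinitesimal decrease property `V⁰(t,x;f(t,x,d)) ≤ -V(t,x)`, and a local Lipschitz
property, implies that `0` is URGAS. -/
theorem stmt10 (n l : ℕ) (r : ℝ) (hr : 0 ≤ r) (D : Set (Euc l)) (hD : D.Nonempty)
    (f : ℝ → (ℝ → Euc n) → Euc l → Euc n)
    (hf0 : ∀ t d, 0 ≤ t → d ∈ D → f t (fun _ => (0 : Euc n)) d = 0)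
    (h1 : H1 n l r D f) (h2 : H2 n l r D f) (h3 : H3 n l r D f) (h4 : H4 n l r D f)
    (V : ℝ → (ℝ → Euc n) → ℝ)
    (hVcont : ∀ t x, 0 ≤ t → ContinuousOn x (Icc (-r) 0) → ∀ ε > 0, ∃ δ > 0,
      ∀ t' x', 0 ≤ t' → ContinuousOn x' (Icc (-r) 0) →
        |t' - t| + histNorm n r (x' - x) < δ → |V t' x' - V t x| < ε)
    (hVnn : ∀ t x, 0 ≤ t → ContinuousOn x (Icc (-r) 0) → 0 ≤ V t x)
    (a₁ a₂ : ℝ → ℝ) (ha₁ : IsKInf a₁) (ha₂ : IsKInf a₂)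
    (hbound : ∀ t x, 0 ≤ t → ContinuousOn x (Icc (-r) 0) →
      a₁ (histNorm n r x) ≤ V t x ∧ V t x ≤ a₂ (histNorm n r x))
    (hdecr : ∀ t x d, 0 ≤ t → ContinuousOn x (Icc (-r) 0) → d ∈ D →
      Vdot n r V t x (f t x d) ≤ ((-(V t x) : ℝ) : EReal))
    (M : ℝ → ℝ) (hMnn : ∀ R, 0 ≤ R → 0 ≤ M R) (hMmono : MonotoneOn M (Ici 0))
    (hVlip : ∀ R, 0 ≤ R → ∀ t x y, t ∈ Icc 0 R →
      ContinuousOn x (Icc (-r) 0) → ContinuousOn y (Icc (-r) 0) →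
      histNorm n r x ≤ R → histNorm n r y ≤ R →
      |V t y - V t x| ≤ M R * histNorm n r (y - x)) :
    URGAS n l r D f := by
  obtain ⟨e, he⟩ := ha₁.exists_orderIso
  have he₀ : e 0 = 0 := by rw [he 0 le_rfl, ha₁.2.2.1]
  refine ⟨fun s t => e.symm (a₂ s * Real.exp (-t)), isKL_inverse_mul_exp ha₂ e he₀, ?_, ?_⟩
  · intro t₀ x₀ d ht₀ hx₀ hd
    obtain ⟨R, hRlt, hR⟩ : ∃ R, a₂ (histNorm n r x₀) < a₁ R ∧ 0 < R :=
      ((ha₁.2.2.2.2.eventually_gt_atTop _).and (eventually_gt_atTop 0)).exists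
    set g : ℝ → (ℝ → Euc n) → Euc l → Euc n :=
      fun t x e => f t (fun θ => ballRetract R (x θ)) e
    have hPc : Continuous (ballRetract R : Euc n → Euc n) := continuous_ballRetract hR
    have hgb : ∀ T, ∃ C, ∀ t x e, 0 ≤ t → t ≤ T → ContinuousOn x (Icc (-r) 0) → e ∈ D →
        ‖g t x e‖ ≤ C := fun T => by
      obtain ⟨C, hC⟩ := h2 T R
      exact ⟨C, fun t x e ht htT hx he => hC t _ e ht htT (hPc.comp_continuousOn hx)
        (histNorm_le hr fun θ _ => norm_ballRetract_le hR _) he⟩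
    obtain ⟨x, hxc, ⟨-, hsol⟩, hhist⟩ :=
      exists_isSolGlobal_of_bounded hr (h3.comp_continuous hr hPc) hgb hd ht₀ hx₀
    have hgf : ∀ t, (∀ u ∈ Icc (t₀ - r) t, ‖x u‖ ≤ R) → ∀ s ∈ Icc t₀ t,
        g s (fun θ => x (s + θ)) (d s) = f s (fun θ => x (s + θ)) (d s) := by
      intro t hle s hs
      have hs₀ : 0 ≤ s := ht₀.trans hs.1
      refine h3.congr hr hs₀ (hd.1 s hs₀) (hPc.comp (hxc.comp (by fun_prop))).continuousOn
        fun θ hθ => ballRetract_of_norm_le hR (hle _ ⟨?_, ?_⟩)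
      · linarith [hθ.1, hs.1]
      · linarith [hθ.2, hs.2]
    have hfsol : ∀ t, t₀ ≤ t → (∀ u ∈ Icc (t₀ - r) t, ‖x u‖ ≤ R) →
        IntervalIntegrable (fun s => f s (fun θ => x (s + θ)) (d s)) volume t₀ t ∧
        x t = x t₀ + ∫ s in t₀..t, f s (fun θ => x (s + θ)) (d s) := by
      intro t ht hle
      obtain ⟨hi, he⟩ := hsol t ht
      have hcongr : EqOn (fun s => g s (fun θ => x (s + θ)) (d s))
          (fun s => f s (fun θ => x (s + θ)) (d s)) (uIcc t₀ t) := fun s hs =>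
        hgf t hle s (by rwa [uIcc_of_le ht] at hs)
      exact ⟨hi.congr (hcongr.mono uIoc_subset_uIcc),
        he.trans (by rw [intervalIntegral.integral_congr hcongr])⟩
    have hhist₀ : histNorm n r (fun θ => x (t₀ + θ)) = histNorm n r x₀ := histNorm_congr hhist
    have hstrict : ∀ t, t₀ ≤ t → (∀ u ∈ Icc (t₀ - r) t, ‖x u‖ ≤ R) → ‖x t‖ < R := by
      intro t ht hle
      have hxt : Continuous fun θ => x (t + θ) := hxc.comp (by fun_prop)
      have hxt₀ : Continuous fun θ => x (t₀ + θ) := hxc.comp (by fun_prop)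
      have hdecay := lyapunov_le_mul_exp hr h3 hVcont hdecr hd ht₀ ht hxc.continuousOn
        (hfsol t ht hle).1 fun s hs =>
          (hfsol s hs.1 fun u hu => hle u ⟨hu.1, hu.2.trans hs.2⟩).2
      have hV : a₁ (histNorm n r fun θ => x (t + θ)) < a₁ R := by
        refine ((hbound t _ (ht₀.trans ht) hxt.continuousOn).1.trans hdecay).trans_lt ?_
        refine (mul_le_of_le_one_right (hVnn t₀ _ ht₀ hxt₀.continuousOn)
          (Real.exp_le_one_iff.2 (by linarith))).trans_lt ?_
        refine (hbound t₀ _ ht₀ hxt₀.continuousOn).2.trans_lt ?_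
        rwa [hhist₀]
      have hlt := (ha₁.2.1.lt_iff_lt (histNorm_nonneg _) hR.le).1 hV
      simpa using (norm_le_histNorm hxt.continuousOn
        (right_mem_Icc.2 (neg_nonpos.2 hr))).trans_lt hlt
    have hinit : ∀ u ∈ Icc (t₀ - r) t₀, ‖x u‖ < R := by
      intro u hu
      have hθ : u - t₀ ∈ Icc (-r) 0 := ⟨by linarith [hu.1], by linarith [hu.2]⟩
      have hx₀R : histNorm n r x₀ < R := by
        refine (ha₁.2.1.lt_iff_lt (histNorm_nonneg _) hR.le).1 ?_
        exact ((hbound t₀ x₀ ht₀ hx₀).1.trans (hbound t₀ x₀ ht₀ hx₀).2).trans_lt hRlt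
      rw [← add_sub_cancel t₀ u, hhist _ hθ]
      exact (norm_le_histNorm hx₀ hθ).trans_lt hx₀R
    have hbdd : ∀ t, ∀ u ∈ Icc (t₀ - r) t, ‖x u‖ ≤ R := by
      by_contra! hcon
      obtain ⟨-, t₂, ⟨ht₂, -⟩, hxt₂⟩ := hcon
      have ht₀₂ : t₀ ≤ t₂ := by
        by_contra! hlt
        exact absurd (hinit t₂ ⟨ht₂, hlt.le⟩) hxt₂.le.not_gt
      obtain ⟨t₁, ⟨ht₁, hxt₁⟩, hmin⟩ :=
        (isCompact_Icc.inter_right (isClosed_le continuous_const hxc.norm)).exists_isLeast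
          (s := Icc t₀ t₂ ∩ {u | R ≤ ‖x u‖}) ⟨t₂, ⟨ht₀₂, le_rfl⟩, hxt₂.le⟩
      obtain ⟨u, hu, hxu⟩ := intermediate_value_Icc ht₁.1 hxc.norm.continuousOn
        ⟨(hinit t₀ ⟨by linarith, le_rfl⟩).le, hxt₁⟩
      have hut₁ : t₁ ≤ u := hmin ⟨⟨hu.1, hu.2.trans ht₁.2⟩, hxu.ge⟩
      obtain rfl : u = t₁ := le_antisymm hu.2 hut₁
      refine (hstrict u ht₁.1 fun v hv => ?_).ne hxu
      rcases le_total v t₀ with hvt | hvt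
      · exact (hinit v ⟨hv.1, hvt⟩).le
      · by_contra! hxv
        have huv : u = v := le_antisymm (hmin ⟨⟨hvt, hv.2.trans ht₁.2⟩, hxv.le⟩) hv.2
        exact hxv.ne (huv ▸ hxu.symm)
    exact ⟨x, ⟨hxc.continuousOn, fun t ht => hfsol t ht (hbdd t)⟩, hhist⟩
  · intro t₀ x₀ d x ht₀ hx₀ hd hsol hhist t ht
    have hxc : ContinuousOn x (Icc (t₀ - r) t) := hsol.1.mono Icc_subset_Ici_self
    have hdecay := lyapunov_le_mul_exp hr h3 hVcont hdecr hd ht₀ ht hxc (hsol.2 t ht).1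
      fun s hs => (hsol.2 s hs.1).2
    rw [OrderIso.le_symm_apply, he _ (histNorm_nonneg _), ← histNorm_congr hhist]
    refine ((hbound t _ (ht₀.trans ht)
      (continuousOn_history hxc ⟨ht, le_rfl⟩)).1.trans hdecay).trans ?_
    exact mul_le_mul_of_nonneg_right
      (hbound t₀ _ ht₀ (continuousOn_history hxc ⟨le_rfl, ht⟩)).2 (Real.exp_pos _).le
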